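/- Let U be a finite set with |U| = q ≥ 1, let F_1,…,F_r be subsets of U with r ≥ 1, let k ≥ 0 be an integer, let r' = max{q, r, k}, and set F_j = U for every j with r < j ≤ r'. Construct the chores instance with r'+k+2 agents — edge agents 1,…,r', color agents r'+1, r'+2, and dummy agents r'+3,…,r'+k+2 — and chores consisting of vertex chores c_1,…,c_q (one per element of U) and dummy chores c_{q+1},…,c_{q+r'}. Valuations: every agent values every dummy chore at -1; edge agent i values vertex chore c_j at -1 if the j-th element of U belongs to F_i and at 0 otherwise; color agents and dummy agents value every vertex chore at 0. Then this instance admits a DEF-k allocation if and only if there exists a partition of U into disjoint sets U_1 and U_2 such that for every j ∈ {1,…,r'} the set F_j intersects both U_1 and U_2. (This is the reduction from SET SPLITTING showing that deciding the existence of a DEF-k allocation is NP-complete for binary valuations.) -/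

import Mathlib

open Finset

variable {N M : Type*}

/-- An allocation partitions the chores `M` into bundles, one per agent. -/
def IsAllocation [DecidableEq M] (A : N → Finset M) : Prop :=
  (∀ i j : N, i ≠ j → Disjoint (A i) (A j)) ∧ ∀ c : M, ∃ i : N, c ∈ A i

/-- Additive value of a bundle. -/
def val (v : M → ℤ) (S : Finset M) : ℤ := ∑ c ∈ S, v c

/-- Envy-freeness up to `k` dubious chores. -/
def DEF [Fintype N] (v : N → M → ℤ) (A : N → Finset M) (k : ℕ) : Prop :=
  ∃ D : N → Multiset M,
    (∑ i : N, Multiset.card (D i)) ≤ k ∧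
    ∀ i h : N, i ≠ h →
      val (v i) (A i) ≥ val (v i) (A h) + (Multiset.map (v i) (D h)).sum

/-- Envy-freeness up to one chore. -/
def EF1 [DecidableEq M] (v : N → M → ℤ) (A : N → Finset M) : Prop :=
  ∀ i h : N, i ≠ h → A i ≠ ∅ →
    ∃ c ∈ A i, val (v i) ((A i).erase c) ≥ val (v i) (A h)

/-- Pareto optimality. -/
def ParetoOptimal [DecidableEq M] (v : N → M → ℤ) (A : N → Finset M) : Prop :=
  ¬ ∃ B : N → Finset M, IsAllocation B ∧
      (∀ i, val (v i) (B i) ≥ val (v i) (A i)) ∧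
      ∃ j, val (v j) (B j) > val (v j) (A j)

/-- Total price of a bundle. -/
def price (p : M → ℝ) (S : Finset M) : ℝ := ∑ c ∈ S, p c

/-- Fisher market equilibrium: prices are positive and every agent receives only
its minimum pain per buck chores. -/
def FisherEq (v : N → M → ℤ) (p : M → ℝ) (A : N → Finset M) : Prop :=
  (∀ c, 0 < p c) ∧
  ∀ i : N, ∀ c ∈ A i, ∀ c' : M, |(v i c : ℝ)| / p c ≤ |(v i c' : ℝ)| / p c'

/-- Price envy-freeness up to one item. -/
def pEF1 [DecidableEq M] (p : M → ℝ) (A : N → Finset M) : Prop :=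
  ∀ i j : N, A i = ∅ ∨ ∃ c ∈ A i, price p ((A i).erase c) ≤ price p (A j)

lemma val_nonpos {v : M → ℤ} (hv : ∀ c, v c ≤ 0) (S : Finset M) : val v S ≤ 0 :=
  Finset.sum_nonpos fun c _ => hv c

lemma val_mono {v : M → ℤ} (hv : ∀ c, v c ≤ 0) {S T : Finset M} (h : S ⊆ T) :
    val v T ≤ val v S := by
  classical
  have h_split : val v (T \ S) + val v S = val v T := Finset.sum_sdiff h
  linarith [val_nonpos hv (T \ S)]

lemma neg_card_le_val {v : M → ℤ} (hv : ∀ c, -1 ≤ v c) (S : Finset M) :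
    -(S.card : ℤ) ≤ val v S := by
  simpa [_root_.val] using Finset.card_nsmul_le_sum S v (-1) fun c _ => hv c

lemma val_le_of_mem {v : M → ℤ} (hv : ∀ c, v c ≤ 0) {S : Finset M} {c : M} (hc : c ∈ S) :
    val v S ≤ v c := by
  simpa [_root_.val] using val_mono hv (Finset.singleton_subset_iff.2 hc)

lemma neg_card_le_sum_map {v : M → ℤ} (hv : ∀ c, -1 ≤ v c) (D : Multiset M) :
    -(Multiset.card D : ℤ) ≤ (D.map v).sum := by
  induction D using Multiset.induction_on with
  | empty => simp
  | cons c D ih =>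
    simp only [Multiset.card_cons, Multiset.map_cons, Multiset.sum_cons]
    push_cast
    linarith [hv c]

lemma sum_map_nonpos {v : M → ℤ} (hv : ∀ c, v c ≤ 0) (D : Multiset M) :
    (D.map v).sum ≤ 0 := by
  induction D using Multiset.induction_on with
  | empty => simp
  | cons c D ih =>
    simp only [Multiset.map_cons, Multiset.sum_cons]
    linarith [hv c]

/-- An allocation is given by the function sending each chore to its owner. -/
lemma IsAllocation.exists_owner [DecidableEq M] {A : N → Finset M} (hA : IsAllocation A) :
    ∃ o : M → N, ∀ c a, c ∈ A a ↔ o c = a := by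
  choose o ho using hA.2
  refine ⟨o, fun c a => ⟨fun h => ?_, fun h => h ▸ ho c⟩⟩
  by_contra hne
  exact Finset.disjoint_left.1 (hA.1 _ _ hne) (ho c) h

lemma isAllocation_of_owner [DecidableEq M] {A : N → Finset M} (o : M → N)
    (ho : ∀ c a, c ∈ A a ↔ o c = a) : IsAllocation A := by
  refine ⟨fun i j hij => Finset.disjoint_left.2 fun c hi hj => hij ?_, fun c => ⟨o c, ?_⟩⟩
  · rw [← (ho c i).1 hi, (ho c j).1 hj]
  · exact (ho c _).2 rfl

lemma sum_card_filter_owner {N M : Type*} [Fintype N] [DecidableEq N] [Fintype M] (o : M → N) :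
    ∑ a, (univ.filter fun c => o c = a).card = Fintype.card M :=
  (Finset.card_eq_sum_card_fiberwise fun _ _ => Finset.mem_coe.2 (Finset.mem_univ _)).symm

/-- the SET SPLITTING reduction: the constructed binary-valuations
instance admits a DEF-k allocation iff the universe can be split so that every set
of the (padded) family meets both parts. -/
theorem exists_def_iff_set_splitting (q r k : ℕ) (hq : 1 ≤ q) (hr : 1 ≤ r)
    (F : Fin r → Finset (Fin q))
    (r' : ℕ) (hr' : r' = max (max q r) k)
    (F' : Fin r' → Finset (Fin q))
    (hF'lt : ∀ (j : Fin r') (h : (j : ℕ) < r), F' j = F ⟨j, h⟩)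
    (hF'ge : ∀ j : Fin r', r ≤ (j : ℕ) → F' j = Finset.univ)
    (v : Fin (r' + k + 2) → (Fin q ⊕ Fin r') → ℤ)
    (hvd : ∀ (a : Fin (r' + k + 2)) (d : Fin r'), v a (Sum.inr d) = -1)
    (hvv : ∀ (a : Fin (r' + k + 2)) (j : Fin q),
      v a (Sum.inl j) =
        if h : (a : ℕ) < r' then (if j ∈ F' ⟨a, h⟩ then -1 else 0) else 0) :
    (∃ A : Fin (r' + k + 2) → Finset (Fin q ⊕ Fin r'),
        IsAllocation A ∧ DEF v A k) ↔
      ∃ U₁ : Finset (Fin q), ∀ j : Fin r',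
        (F' j ∩ U₁).Nonempty ∧ (F' j \ U₁).Nonempty := by
  have hqr : q ≤ r' := by omega
  have hv_nonpos : ∀ a c, v a c ≤ 0 := by
    rintro a (j | d)
    · rw [hvv]; split_ifs <;> simp
    · simp [hvd]
  have hv_ge : ∀ a c, -1 ≤ v a c := by
    rintro a (j | d)
    · rw [hvv]; split_ifs <;> simp
    · simp [hvd]
  constructor
  · rintro ⟨A, hA, D, hD, hdef⟩
    obtain ⟨o, ho⟩ := hA.exists_owner
    have hA_eq : ∀ a, A a = univ.filter fun c => o c = a := fun a => by ext c; simp [ho]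
    -- every dummy chore is held by an edge agent
    have h_edge : ∀ d, (o (Sum.inr d) : ℕ) < r' := by
      intro d
      by_contra h_not
      set a := o (Sum.inr d) with ha
      have hv_inl : ∀ j, v a (Sum.inl j) = 0 := fun j => by rw [hvv, dif_neg h_not]
      have h_val : ∀ h, val (v a) (A h) =
          -((univ.filter fun e => o (Sum.inr e) = h).card : ℤ) := by
        intro h
        rw [hA_eq, _root_.val, Finset.sum_filter, Fintype.sum_sum_type]
        simp [hv_inl, hvd, Finset.sum_ite]
      have h_pos : ∀ h, 1 ≤ (univ.filter fun e => o (Sum.inr e) = h).card +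
          Multiset.card (D h) := by
        intro h
        have h_own : 1 ≤ (univ.filter fun e => o (Sum.inr e) = a).card :=
          Finset.card_pos.2 ⟨d, by simp [ha]⟩
        by_cases hah : a = h
        · subst hah; omega
        · have h_envy := hdef a h hah
          rw [h_val, h_val] at h_envy
          have h_dub := neg_card_le_sum_map (hv_ge a) (D h)
          omega
      have h_sum := Finset.sum_le_sum fun h (_ : h ∈ univ) => h_pos h
      rw [Finset.sum_add_distrib, sum_card_filter_owner fun e => o (Sum.inr e)] at h_sum
      simp at h_sum
      omega
    -- no agent holds two dummy chores
    have h_inj : Function.Injective fun d : Fin r' => (⟨o (Sum.inr d), h_edge d⟩ : Fin r') := by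
      intro d e hde
      by_contra h_ne
      have hoe : o (Sum.inr e) = o (Sum.inr d) := by
        simp only [Fin.mk.injEq] at hde
        exact (Fin.ext hde).symm
      set a := o (Sum.inr d) with ha
      have h_sub : ({Sum.inr d, Sum.inr e} : Finset (Fin q ⊕ Fin r')) ⊆ A a := by
        intro c hc
        rw [ho]
        rcases Finset.mem_insert.1 hc with rfl | hc
        · rfl
        · rw [Finset.mem_singleton.1 hc, hoe]
      have h_two : ({Sum.inr d, Sum.inr e} : Finset (Fin q ⊕ Fin r')).card = 2 :=
        Finset.card_pair (by simpa using h_ne)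
      have h_own : val (v a) (A a) ≤ -2 := by
        refine (val_mono (hv_nonpos a) h_sub).trans (le_of_eq ?_)
        rw [_root_.val, Finset.sum_pair (by simpa using h_ne), hvd, hvd]
        norm_num
      have h_pos : ∀ h, 2 ≤ (A h).card + Multiset.card (D h) := by
        intro h
        by_cases hah : a = h
        · subst hah
          have h_card := Finset.card_le_card h_sub
          omega
        · have h_envy := hdef a h hah
          have h_dub := neg_card_le_sum_map (hv_ge a) (D h)
          have h_card := neg_card_le_val (hv_ge a) (A h)
          omega
      have h_sum := Finset.sum_le_sum fun h (_ : h ∈ univ) => h_pos h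
      simp only [hA_eq] at h_sum
      rw [Finset.sum_add_distrib, sum_card_filter_owner] at h_sum
      simp at h_sum
      omega
    have h_surj := Finite.injective_iff_surjective.1 h_inj
    -- two agents outside the edge agents have no dubious chores
    let e : Fin (k + 2) ↪ Fin (r' + k + 2) :=
      ⟨fun j => ⟨r' + j, by omega⟩, fun i j hij => by simpa [Fin.ext_iff] using hij⟩
    have he : ∀ j, (e j : ℕ) = r' + j := fun _ => rfl
    have h_two : 1 < (univ.filter fun j => D (e j) = 0).card := by
      have h_le : ∑ j, Multiset.card (D (e j)) ≤ k := by
        rw [← Finset.sum_map univ e fun a => Multiset.card (D a)]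
        exact (Finset.sum_le_sum_of_subset (Finset.subset_univ _)).trans hD
      have h_one : ∀ j, 1 ≤ (if D (e j) = 0 then 1 else 0) + Multiset.card (D (e j)) := by
        intro j
        split_ifs with h
        · omega
        · have h_card := Multiset.card_pos.2 h
          omega
      have h_sum := Finset.sum_le_sum fun j (_ : j ∈ univ) => h_one j
      rw [Finset.sum_add_distrib, ← Finset.card_filter] at h_sum
      simp only [Finset.sum_const, Finset.card_univ, Fintype.card_fin, smul_eq_mul] at h_sum
      omega
    obtain ⟨x, hx, y, hy, hxy⟩ := Finset.one_lt_card.1 h_two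
    have h_meet : ∀ z, D (e z) = 0 → ∀ j : Fin r', ∃ u ∈ F' j, o (Sum.inl u) = e z := by
      intro z hz j
      obtain ⟨d, hd⟩ := h_surj j
      have hjlt := j.isLt
      have h_own : o (Sum.inr d) = (⟨j, by omega⟩ : Fin (r' + k + 2)) := by
        ext
        simpa [Fin.ext_iff] using hd
      set a : Fin (r' + k + 2) := ⟨j, by omega⟩ with ha
      have h_neg : val (v a) (A a) ≤ -1 := by
        simpa [hvd] using val_le_of_mem (hv_nonpos a) ((ho _ _).2 h_own)
      have haz : a ≠ e z := by
        rw [ne_eq, Fin.ext_iff, he]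
        exact (hjlt.trans_le (Nat.le_add_right _ _)).ne
      have h_envy := hdef a (e z) haz
      rw [hz] at h_envy
      simp only [Multiset.map_zero, Multiset.sum_zero, add_zero] at h_envy
      have h_lt : val (v a) (A (e z)) < 0 := by omega
      obtain ⟨c, hc, hvc⟩ := Finset.exists_lt_of_sum_lt
        (show ∑ c ∈ A (e z), v a c < ∑ c ∈ A (e z), 0 by simpa [_root_.val] using h_lt)
      rw [ho] at hc
      rcases c with u | d'
      · refine ⟨u, ?_, hc⟩
        by_contra hu
        rw [hvv, dif_pos hjlt, if_neg hu] at hvc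
        exact lt_irrefl _ hvc
      · have h_lt := h_edge d'
        rw [hc, he] at h_lt
        omega
    refine ⟨univ.filter fun u => o (Sum.inl u) = e x, fun j => ?_⟩
    obtain ⟨u, hu, hux⟩ := h_meet x (Finset.mem_filter.1 hx).2 j
    obtain ⟨w, hw, hwy⟩ := h_meet y (Finset.mem_filter.1 hy).2 j
    refine ⟨⟨u, by simp [hu, hux]⟩, ⟨w, ?_⟩⟩
    simp only [Finset.mem_sdiff, Finset.mem_filter, Finset.mem_univ, true_and, hwy]
    exact ⟨hw, fun h => hxy (e.injective h).symm⟩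
  · rintro ⟨U, hU⟩
    let o : Fin q ⊕ Fin r' → Fin (r' + k + 2) := Sum.elim
      (fun u => if u ∈ U then ⟨r', by omega⟩ else ⟨r' + 1, by omega⟩)
      (fun d => ⟨d, by omega⟩)
    let A : Fin (r' + k + 2) → Finset (Fin q ⊕ Fin r') := fun a => univ.filter fun c => o c = a
    have ho : ∀ c a, c ∈ A a ↔ o c = a := fun c a => by simp [A]
    let d₀ : Fin r' := ⟨0, by omega⟩
    let D : Fin (r' + k + 2) → Multiset (Fin q ⊕ Fin r') :=
      fun a => if r' + 2 ≤ (a : ℕ) then {Sum.inr d₀} else 0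
    have ho_inl : ∀ u, r' ≤ (o (Sum.inl u) : ℕ) := by
      intro u
      simp only [o, Sum.elim_inl]
      split_ifs <;> simp
    refine ⟨A, isAllocation_of_owner o ho, D, ?_, fun a h hah => ?_⟩
    · have h_card : ∀ a, Multiset.card (D a) = if r' + 2 ≤ (a : ℕ) then 1 else 0 := by
        intro a
        simp only [D]
        split_ifs <;> simp
      simp only [h_card]
      rw [Fin.sum_univ_eq_sum_range (fun a => if r' + 2 ≤ a then 1 else 0),
        ← Finset.card_filter]
      have h_sub : ((range (r' + k + 2)).filter fun a => r' + 2 ≤ a) ⊆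
          Finset.Ico (r' + 2) (r' + k + 2) := by
        intro a ha
        simp only [Finset.mem_filter, Finset.mem_range, Finset.mem_Ico] at ha ⊢
        omega
      have h_le := Finset.card_le_card h_sub
      rw [Nat.card_Ico] at h_le
      omega
    · have h_val := val_nonpos (hv_nonpos a) (A h)
      have h_dub := sum_map_nonpos (hv_nonpos a) (D h)
      by_cases har : (a : ℕ) < r'
      · have h_own : A a = {Sum.inr ⟨a, har⟩} := by
          ext c
          rw [ho, Finset.mem_singleton]
          rcases c with u | d
          · have h_ge := ho_inl u
            simp only [reduceCtorEq, iff_false]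
            intro h_eq
            rw [h_eq] at h_ge
            omega
          · simp [o, Fin.ext_iff]
        have h_neg : val (v a) (A a) = -1 := by simp [h_own, _root_.val, hvd]
        have h_vertex : ∀ u ∈ F' ⟨a, har⟩, o (Sum.inl u) = h → val (v a) (A h) ≤ -1 := by
          intro u hu huh
          have h_le := val_le_of_mem (hv_nonpos a) ((ho _ _).2 huh)
          rwa [hvv, dif_pos har, if_pos hu] at h_le
        obtain ⟨⟨u, hu⟩, ⟨w, hw⟩⟩ := hU ⟨a, har⟩
        rw [Finset.mem_inter] at hu
        rw [Finset.mem_sdiff] at hw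
        rcases lt_trichotomy (h : ℕ) r' with hh | hh | hh
        · have h_mem : Sum.inr ⟨h, hh⟩ ∈ A h := (ho _ _).2 (by simp [o])
          have h_le := val_le_of_mem (hv_nonpos a) h_mem
          rw [hvd] at h_le
          linarith
        · have h_le := h_vertex u hu.1 (by ext; simp [o, hu.2, hh])
          linarith
        · by_cases hh' : (h : ℕ) = r' + 1
          · have h_le := h_vertex w hw.1 (by ext; simp [o, hw.2, hh'])
            linarith
          · have h_le : r' + 2 ≤ (h : ℕ) := by omega
            have h_sum : ((D h).map (v a)).sum = -1 := by simp [D, h_le, hvd]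
            linarith
      · have h_own : val (v a) (A a) = 0 := by
          refine Finset.sum_eq_zero fun c hc => ?_
          rw [ho] at hc
          rcases c with u | d
          · rw [hvv, dif_neg har]
          · refine absurd ?_ har
            rw [← hc]
            exact d.isLt
        linarith
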